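/- Let 𝒜 and ℬ be abelian categories with enough projectives and injectives and T : ℬ → 𝒜 a right exact compatible functor which preserves projective objects and Gorenstein projective objects. Then (𝔅^{𝒢𝒫_𝒜}_{𝒢𝒫_ℬ}, 𝔅^{𝒫_𝒜}_{𝒫_ℬ}) is a strong left Frobenius pair in the comma category (T↓𝒜), where 𝒢𝒫 denotes the class of Gorenstein projective objects and 𝒫 the class of projective objects. -/

import Mathlib

/-!
Formalization of a statement from "Recollements induced by left Frobenius pairs"
(Ma, Sun, Zhu, Hu). Auxiliary definitions (left Frobenius pairs, the classes
`𝒳̂` and `𝔅^𝒳_𝒴`, etc.) are given first; the statement itself is the final theorem.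
-/

noncomputable section
namespace Paper
open CategoryTheory CategoryTheory.Limits ZeroObject

universe w₁ w₂ w₃ v v' u u'

section Core
variable {𝒜 : Type u} [Category.{v} 𝒜] [Abelian 𝒜]

/-- `C` is isomorphic to some member of the class `𝒳`. -/
def MemIso (𝒳 : Set 𝒜) (C : 𝒜) : Prop := ∃ X ∈ 𝒳, Nonempty (X ≅ C)

/-- `C` admits an exact resolution `0 → X_n → ⋯ → X_0 → C → 0` with all `X_i ∈ 𝒳`. -/
def HasResolutionOfLength (𝒳 : Set 𝒜) : ℕ → 𝒜 → Prop
  | 0, C => MemIso 𝒳 C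
  | (n+1), C => ∃ S : ShortComplex 𝒜, S.ShortExact ∧ S.X₃ = C ∧ S.X₂ ∈ 𝒳 ∧
      HasResolutionOfLength 𝒳 n S.X₁

/-- The class `𝒳̂` of objects admitting a finite exact resolution by objects of `𝒳`. -/
def Hat (𝒳 : Set 𝒜) : Set 𝒜 := {C | ∃ n, HasResolutionOfLength 𝒳 n C}

variable [HasExt.{w₁} 𝒜]

/-- `(𝒳, 𝒲)` is a left Frobenius pair in the abelian category `𝒜`:
`𝒳` is closed under extensions, kernels of epimorphisms and direct summands,
`𝒲` is closed under direct summands, `𝒲 ⊆ 𝒳 ∩ 𝒳^⊥`, and every `X ∈ 𝒳` admits a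
short exact sequence `0 → X → W → X' → 0` with `W ∈ 𝒲`, `X' ∈ 𝒳`. -/
structure IsLeftFrobeniusPair (𝒳 𝒲 : Set 𝒜) : Prop where
  closed_extensions : ∀ S : ShortComplex 𝒜, S.ShortExact → S.X₁ ∈ 𝒳 → S.X₃ ∈ 𝒳 → S.X₂ ∈ 𝒳
  closed_kernels_of_epis : ∀ S : ShortComplex 𝒜, S.ShortExact → S.X₂ ∈ 𝒳 → S.X₃ ∈ 𝒳 → S.X₁ ∈ 𝒳
  closed_summands_X : ∀ C A B : 𝒜, C ∈ 𝒳 → Nonempty (C ≅ A ⊞ B) → A ∈ 𝒳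
  closed_summands_W : ∀ C A B : 𝒜, C ∈ 𝒲 → Nonempty (C ≅ A ⊞ B) → A ∈ 𝒲
  W_subset_X : 𝒲 ⊆ 𝒳
  W_subset_rightPerp : ∀ W ∈ 𝒲, ∀ X ∈ 𝒳, ∀ i : ℕ, 1 ≤ i → Subsingleton (Abelian.Ext X W i)
  cogenerator : ∀ X ∈ 𝒳, ∃ S : ShortComplex 𝒜, S.ShortExact ∧ S.X₁ = X ∧ S.X₂ ∈ 𝒲 ∧ S.X₃ ∈ 𝒳

/-- `(𝒳, 𝒲)` is a strong left Frobenius pair: a left Frobenius pair such that moreover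
`𝒲 ⊆ ^⊥𝒳` and every `X ∈ 𝒳` admits a short exact sequence `0 → X' → W → X → 0`
with `W ∈ 𝒲`, `X' ∈ 𝒳`. -/
structure IsStrongLeftFrobeniusPair (𝒳 𝒲 : Set 𝒜) extends IsLeftFrobeniusPair 𝒳 𝒲 : Prop where
  W_subset_leftPerp : ∀ W ∈ 𝒲, ∀ X ∈ 𝒳, ∀ i : ℕ, 1 ≤ i → Subsingleton (Abelian.Ext W X i)
  generator : ∀ X ∈ 𝒳, ∃ S : ShortComplex 𝒜, S.ShortExact ∧ S.X₃ = X ∧ S.X₂ ∈ 𝒲 ∧ S.X₁ ∈ 𝒳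

end Core

section CommaDefs
variable {𝒜 : Type u} [Category.{v} 𝒜] [Abelian 𝒜]
  {ℬ : Type u'} [Category.{v'} ℬ] [Abelian ℬ] (T : ℬ ⥤ 𝒜)

/-- The class `𝔅^𝒳_𝒴` in the comma category `(T ↓ 𝒜)`, consisting of the objects
`(X, Y, φ : T Y ⟶ X)` with `Y ∈ 𝒴`, `φ` a monomorphism and `Coker φ ∈ 𝒳`. -/
def CommaClass (𝒳 : Set 𝒜) (𝒴 : Set ℬ) : Set (Comma T (𝟭 𝒜)) :=
  {Z | Z.left ∈ 𝒴 ∧ Mono Z.hom ∧ MemIso 𝒳 (cokernel Z.hom)}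

end CommaDefs

section GorensteinProjective
variable {𝒜 : Type u} [Category.{v} 𝒜] [Abelian 𝒜]

/-- The complex `Hom_𝒜(P^•, Q)` of abelian groups is exact. -/
def HomComplexExact (P : CochainComplex 𝒜 ℤ) (Q : 𝒜) : Prop :=
  ∀ n, ((((preadditiveYoneda.obj Q).mapHomologicalComplex _).obj
    (HomologicalComplex.op P)).ExactAt n)

/-- `M` is a Gorenstein projective object: `M ≅ Z⁰(P^•)` for some acyclic complex `P^•`
of projective objects such that `Hom(P^•, Q)` is exact for every projective `Q`. -/
def IsGorensteinProjective (M : 𝒜) : Prop :=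
  ∃ P : CochainComplex 𝒜 ℤ,
    (∀ n, Projective (P.X n)) ∧ (∀ n, P.ExactAt n) ∧
    (∀ Q : 𝒜, Projective Q → HomComplexExact P Q) ∧
    Nonempty (M ≅ P.cycles 0)

/-- A complete projective resolution: an acyclic complex of projective objects which stays
exact after applying `Hom(-, Q)` for every projective `Q`. -/
def IsCompleteProjectiveResolution (P : CochainComplex 𝒜 ℤ) : Prop :=
  (∀ n, Projective (P.X n)) ∧ (∀ n, P.ExactAt n) ∧
    ∀ Q : 𝒜, Projective Q → HomComplexExact P Q

variable {ℬ : Type u'} [Category.{v'} ℬ] [Abelian ℬ]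

/-- Condition (C1): `T` sends exact complexes of projective objects to exact complexes. -/
def CompatibleC1 (T : ℬ ⥤ 𝒜) [T.Additive] : Prop :=
  ∀ Q : CochainComplex ℬ ℤ, (∀ n, Projective (Q.X n)) → (∀ n, Q.ExactAt n) →
    ∀ n, ((T.mapHomologicalComplex _).obj Q).ExactAt n

/-- Condition (C2): `Hom_𝒜(P^•, T Q)` is exact for every complete `𝒜`-projective
resolution `P^•` and every projective object `Q` of `ℬ`. -/
def CompatibleC2 (T : ℬ ⥤ 𝒜) : Prop :=
  ∀ P : CochainComplex 𝒜 ℤ, IsCompleteProjectiveResolution P →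
    ∀ Q : ℬ, Projective Q → HomComplexExact P (T.obj Q)

/-- `T` is a compatible functor. -/
def Compatible (T : ℬ ⥤ 𝒜) [T.Additive] : Prop := CompatibleC1 T ∧ CompatibleC2 T

end GorensteinProjective

end Paper

open CategoryTheory CategoryTheory.Limits ZeroObject Paper

universe w₁ w₂ w₃ v v' u u'

namespace Paper

section ExtLemmas

variable {𝒜 : Type u} [Category.{v} 𝒜] [Abelian 𝒜] [HasExt.{w₁} 𝒜]

lemma exists_extension_of_ext_one {S : ShortComplex 𝒜} (hS : S.ShortExact) (Q : 𝒜)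
    [Subsingleton (Abelian.Ext.{w₁} S.X₃ Q 1)] (a : S.X₁ ⟶ Q) : ∃ b : S.X₂ ⟶ Q, S.f ≫ b = a := by
  obtain ⟨x, hx⟩ := Abelian.Ext.contravariant_sequence_exact₁ hS Q (Abelian.Ext.mk₀ a)
    (add_zero 1) (Subsingleton.elim _ _)
  refine ⟨Abelian.Ext.homEquiv₀ x, (Abelian.Ext.mk₀_bijective _ _).1 ?_⟩
  rw [← Abelian.Ext.mk₀_comp_mk₀, Abelian.Ext.mk₀_homEquiv₀_apply, hx]

lemma ext_one_of_exists_extension {S : ShortComplex 𝒜} (hS : S.ShortExact) [Projective S.X₂]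
    (Q : 𝒜) (h : ∀ a : S.X₁ ⟶ Q, ∃ b : S.X₂ ⟶ Q, S.f ≫ b = a) :
    Subsingleton (Abelian.Ext.{w₁} S.X₃ Q 1) := by
  refine subsingleton_of_forall_eq 0 fun x => ?_
  obtain ⟨y, rfl⟩ := Abelian.Ext.contravariant_sequence_exact₃ hS Q x
    (Abelian.Ext.eq_zero_of_projective _) (add_zero 1)
  obtain ⟨b, hb⟩ := h (Abelian.Ext.homEquiv₀ y)
  rw [← Abelian.Ext.mk₀_homEquiv₀_apply y, ← hb, ← Abelian.Ext.mk₀_comp_mk₀,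
    ShortComplex.ShortExact.extClass_comp_assoc]

lemma ext_succ_of_projective {S : ShortComplex 𝒜} (hS : S.ShortExact) [Projective S.X₂]
    (Q : 𝒜) {n : ℕ} (h : Subsingleton (Abelian.Ext.{w₁} S.X₁ Q n)) :
    Subsingleton (Abelian.Ext.{w₁} S.X₃ Q (n + 1)) := by
  refine subsingleton_of_forall_eq 0 fun x => ?_
  obtain ⟨y, rfl⟩ := Abelian.Ext.contravariant_sequence_exact₃ hS Q x
    (Abelian.Ext.eq_zero_of_projective _) (add_comm 1 n)
  rw [Subsingleton.elim y 0, Abelian.Ext.comp_zero]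

lemma ext_middle {S : ShortComplex 𝒜} (hS : S.ShortExact) (Q : 𝒜) {n : ℕ}
    (h₁ : Subsingleton (Abelian.Ext.{w₁} S.X₁ Q n))
    (h₃ : Subsingleton (Abelian.Ext.{w₁} S.X₃ Q n)) :
    Subsingleton (Abelian.Ext.{w₁} S.X₂ Q n) := by
  refine subsingleton_of_forall_eq 0 fun x => ?_
  obtain ⟨y, rfl⟩ := Abelian.Ext.contravariant_sequence_exact₂ hS Q x (Subsingleton.elim _ _)
  rw [Subsingleton.elim y 0, Abelian.Ext.comp_zero]

lemma ext_left {S : ShortComplex 𝒜} (hS : S.ShortExact) (Q : 𝒜) {n : ℕ}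
    (h₂ : Subsingleton (Abelian.Ext.{w₁} S.X₂ Q n))
    (h₃ : Subsingleton (Abelian.Ext.{w₁} S.X₃ Q (n + 1))) :
    Subsingleton (Abelian.Ext.{w₁} S.X₁ Q n) := by
  refine subsingleton_of_forall_eq 0 fun x => ?_
  obtain ⟨y, rfl⟩ := Abelian.Ext.contravariant_sequence_exact₁ hS Q x (add_comm 1 n)
    (Subsingleton.elim _ _)
  rw [Subsingleton.elim y 0, Abelian.Ext.comp_zero]

lemma ext_of_retract {A B : 𝒜} (r : Retract A B) (Q : 𝒜) {n : ℕ}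
    (h : Subsingleton (Abelian.Ext.{w₁} B Q n)) : Subsingleton (Abelian.Ext.{w₁} A Q n) := by
  refine subsingleton_of_forall_eq 0 fun x => ?_
  rw [← Abelian.Ext.mk₀_id_comp x, ← r.retract, ← Abelian.Ext.mk₀_comp_mk₀_assoc,
    Subsingleton.elim ((Abelian.Ext.mk₀ r.r).comp x (zero_add n)) 0, Abelian.Ext.comp_zero]

end ExtLemmas

section Gorenstein

variable {𝒜 : Type u} [Category.{v} 𝒜] [Abelian 𝒜]

lemma homComplexExact_iff (P : CochainComplex 𝒜 ℤ) (Q : 𝒜) :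
    HomComplexExact P Q ↔ ∀ (n : ℤ) (f : P.X (n + 1) ⟶ Q), P.d n (n + 1) ≫ f = 0 →
      ∃ g : P.X (n + 1 + 1) ⟶ Q, P.d (n + 1) (n + 1 + 1) ≫ g = f := by
  have key (n : ℤ) : ((((preadditiveYoneda.obj Q).mapHomologicalComplex _).obj
      (HomologicalComplex.op P)).ExactAt (n + 1)) ↔
      ∀ (f : P.X (n + 1) ⟶ Q), P.d n (n + 1) ≫ f = 0 →
      ∃ g : P.X (n + 1 + 1) ⟶ Q, P.d (n + 1) (n + 1 + 1) ≫ g = f := by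
    rw [HomologicalComplex.exactAt_iff' _ (n + 1 + 1) (n + 1) n
      (ComplexShape.prev_eq' _ (by simp)) (ComplexShape.next_eq' _ (by simp)),
      ShortComplex.ab_exact_iff]
    rfl
  constructor
  · exact fun h n => (key n).1 (h _)
  · intro h n
    obtain ⟨m, rfl⟩ : ∃ m, n = m + 1 := ⟨n - 1, by ring⟩
    exact (key m).2 (h m)

lemma exactAt_succ_iff (P : CochainComplex 𝒜 ℤ) (n : ℤ) : P.ExactAt (n + 1) ↔
    (ShortComplex.mk (P.d n (n + 1)) (P.d (n + 1) (n + 1 + 1)) (P.d_comp_d _ _ _)).Exact :=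
  HomologicalComplex.exactAt_iff' P n (n + 1) (n + 1 + 1) (by simp) (by simp)

lemma exact_splice {X Z₁ Y Z₂ W : 𝒜} {i : Z₁ ⟶ Y} {p : Y ⟶ Z₂} (w : i ≫ p = 0)
    (h : (ShortComplex.mk i p w).Exact) (e : X ⟶ Z₁) [Epi e] (m : Z₂ ⟶ W) [Mono m] :
    (ShortComplex.mk (e ≫ i) (p ≫ m) (by simp [reassoc_of% w])).Exact := by
  let S := ShortComplex.mk (e ≫ i) p (by simp [w])
  let α : S ⟶ ShortComplex.mk i p w := { τ₁ := e, τ₂ := 𝟙 _, τ₃ := 𝟙 _ }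
  let β : S ⟶ ShortComplex.mk (e ≫ i) (p ≫ m) (by simp [reassoc_of% w]) :=
    { τ₁ := 𝟙 _, τ₂ := 𝟙 _, τ₃ := m }
  have : Epi α.τ₁ := ‹Epi e›
  have : IsIso α.τ₂ := inferInstanceAs (IsIso (𝟙 _))
  have : Mono α.τ₃ := inferInstanceAs (Mono (𝟙 _))
  have : Epi β.τ₁ := inferInstanceAs (Epi (𝟙 _))
  have : IsIso β.τ₂ := inferInstanceAs (IsIso (𝟙 _))
  have : Mono β.τ₃ := ‹Mono m›
  rw [← ShortComplex.exact_iff_of_epi_of_isIso_of_mono β,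
    ShortComplex.exact_iff_of_epi_of_isIso_of_mono α]
  exact h

lemma shortExact_cycles {P : CochainComplex 𝒜 ℤ} (hP : ∀ n, P.ExactAt n) (n : ℤ) :
    (ShortComplex.mk (P.iCycles n) (P.toCycles n (n + 1))
      (by simp [← cancel_mono (P.iCycles (n + 1))])).ShortExact where
  exact := by
    refine ShortComplex.exact_of_f_is_kernel _ ?_
    refine KernelFork.IsLimit.ofι' _ _ fun k hk => ⟨P.liftCycles k (n + 1) (by simp) ?_,
      HomologicalComplex.liftCycles_i ..⟩
    rw [← P.toCycles_i n (n + 1), reassoc_of% hk, zero_comp]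
  epi_g := by
    have := (exactAt_succ_iff P n).1 (hP (n + 1))
    refine (epi_iff_surjective_up_to_refinements _).2 fun A (y : A ⟶ P.cycles (n + 1)) => ?_
    dsimp at y ⊢
    obtain ⟨A', π, hπ, x, hx⟩ := this.exact_up_to_refinements (y ≫ P.iCycles (n + 1))
      (by simp)
    refine ⟨A', π, hπ, x, ?_⟩
    rw [← cancel_mono (P.iCycles (n + 1))]
    simpa using hx

variable [HasExt.{w₁} 𝒜]

/-- `M` has no higher extensions by projective objects. -/
def PerpProjective (M : 𝒜) : Prop :=
  ∀ Q : 𝒜, Projective Q → ∀ n : ℕ, Subsingleton (Abelian.Ext.{w₁} M Q (n + 1))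

lemma perpProjective_cycles {P : CochainComplex 𝒜 ℤ} (hP : IsCompleteProjectiveResolution P)
    (n : ℤ) : PerpProjective.{w₁} (P.cycles n) := by
  intro Q hQ k
  have (n : ℤ) : Projective (ShortComplex.mk (P.iCycles n) (P.toCycles n (n + 1))
      (by simp [← cancel_mono (P.iCycles (n + 1))])).X₂ := hP.1 n
  induction k generalizing n with
  | zero =>
    obtain ⟨m, rfl⟩ : ∃ m, n = m + 1 + 1 := ⟨n - 1 - 1, by ring⟩
    refine ext_one_of_exists_extension (shortExact_cycles hP.2.1 (m + 1)) Q fun a => ?_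
    obtain ⟨l, rfl⟩ : ∃ l, m = l + 1 := ⟨m - 1, by ring⟩
    have := (shortExact_cycles hP.2.1 (l + 1)).epi_g
    dsimp at this
    obtain ⟨g, hg⟩ := (homComplexExact_iff P Q).1 (hP.2.2 Q hQ) l (P.toCycles (l + 1) _ ≫ a)
      (by simp)
    refine ⟨g, ?_⟩
    dsimp
    rw [← cancel_epi (P.toCycles (l + 1) (l + 1 + 1)), ← hg]
    simp
  | succ k ih =>
    obtain ⟨m, rfl⟩ : ∃ m, n = m + 1 := ⟨n - 1, by ring⟩
    exact ext_succ_of_projective (shortExact_cycles hP.2.1 m) Q (ih m)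

lemma PerpProjective.of_iso {M N : 𝒜} (e : M ≅ N) (h : PerpProjective.{w₁} N) :
    PerpProjective.{w₁} M :=
  fun Q hQ n => ext_of_retract e.retract Q (h Q hQ n)

lemma PerpProjective.of_projective (M : 𝒜) [Projective M] : PerpProjective.{w₁} M :=
  fun Q _ n => Abelian.Ext.subsingleton_of_projective M Q n

lemma IsGorensteinProjective.perpProjective {M : 𝒜} (h : IsGorensteinProjective M) :
    PerpProjective.{w₁} M := by
  obtain ⟨P, h₁, h₂, h₃, ⟨e⟩⟩ := h
  exact (perpProjective_cycles ⟨h₁, h₂, h₃⟩ 0).of_iso e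

/-- Splicing short exact sequences `0 ⟶ Z n ⟶ P n ⟶ Z (n + 1) ⟶ 0` with projective middle terms
and with `Z n` orthogonal to projective objects yields a complete projective resolution. -/
lemma isGorensteinProjective_of_sequence (Z P : ℤ → 𝒜) (f : ∀ n, Z n ⟶ P n)
    (g : ∀ n, P n ⟶ Z (n + 1)) (w : ∀ n, f n ≫ g n = 0) (hP : ∀ n, Projective (P n))
    (hZ : ∀ n, PerpProjective.{w₁} (Z n)) (h : ∀ n, (ShortComplex.mk _ _ (w n)).ShortExact) :
    IsGorensteinProjective (Z 0) := by
  let K : CochainComplex 𝒜 ℤ := CochainComplex.of P (fun n => g n ≫ f (n + 1))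
    (fun n => by simp [reassoc_of% (w (n + 1))])
  have hd (n : ℤ) : K.d n (n + 1) = g n ≫ f (n + 1) :=
    CochainComplex.of_d _ (fun n => g n ≫ f (n + 1)) n
  have hmono (n : ℤ) : Mono (f n) := (h n).mono_f
  have hepi (n : ℤ) : Epi (g n) := (h n).epi_g
  have hK (n : ℤ) : K.ExactAt n := by
    obtain ⟨m, rfl⟩ : ∃ m, n = m + 1 := ⟨n - 1, by ring⟩
    rw [exactAt_succ_iff]
    convert exact_splice (w (m + 1)) (h (m + 1)).exact (g m) (f (m + 1 + 1)) using 2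
    · exact hd m
    · exact hd (m + 1)
  refine ⟨K, hP, hK, fun Q hQ => (homComplexExact_iff K Q).2 fun n a ha => ?_, ⟨?_⟩⟩
  · rw [hd, Category.assoc] at ha
    have ha' : f (n + 1) ≫ a = 0 := by rwa [← cancel_epi (g n), comp_zero]
    have := hZ (n + 1 + 1 + 1) Q hQ 0
    obtain ⟨b, hb⟩ := exists_extension_of_ext_one (h (n + 1 + 1)) Q ((h (n + 1)).exact.desc a ha')
    refine ⟨b, ?_⟩
    have ha₀ := (h (n + 1)).exact.g_desc a ha'
    dsimp at hb ha₀
    rw [hd, Category.assoc, hb, ha₀]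
  · exact IsLimit.conePointUniqueUpToIso (isKernelCompMono (h 0).fIsKernel (f (0 + 1)) (hd 0))
      (K.cyclesIsKernel 0 (0 + 1) (by simp))

end Gorenstein

section Snake

variable {𝒜 : Type u} [Category.{v} 𝒜] [Abelian 𝒜]

/-- The row of cokernels of a morphism of short complexes. -/
@[simps]
def cokernelRow {L₁ L₂ : ShortComplex 𝒜} (φ : L₁ ⟶ L₂) : ShortComplex 𝒜 where
  X₁ := cokernel φ.τ₁
  X₂ := cokernel φ.τ₂
  X₃ := cokernel φ.τ₃
  f := cokernel.map φ.τ₁ φ.τ₂ L₁.f L₂.f φ.comm₁₂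
  g := cokernel.map φ.τ₂ φ.τ₃ L₁.g L₂.g φ.comm₂₃
  zero := by ext; simp

/-- The snake diagram of a morphism from a right exact row to a left exact row. -/
def snakeInputOfHom {L₁ L₂ : ShortComplex 𝒜} (h₁ : L₁.Exact) [Epi L₁.g] (h₂ : L₂.Exact)
    [Mono L₂.f] (φ : L₁ ⟶ L₂) : ShortComplex.SnakeInput 𝒜 where
  L₀ :=
    { f := kernel.map φ.τ₁ φ.τ₂ L₁.f L₂.f φ.comm₁₂
      g := kernel.map φ.τ₂ φ.τ₃ L₁.g L₂.g φ.comm₂₃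
      zero := by ext; simp }
  L₁ := L₁
  L₂ := L₂
  L₃ := cokernelRow φ
  v₀₁ :=
    { τ₁ := kernel.ι φ.τ₁
      τ₂ := kernel.ι φ.τ₂
      τ₃ := kernel.ι φ.τ₃ }
  v₁₂ := φ
  v₂₃ :=
    { τ₁ := cokernel.π φ.τ₁
      τ₂ := cokernel.π φ.τ₂
      τ₃ := cokernel.π φ.τ₃
      comm₁₂ := cokernel.π_desc _ _ _
      comm₂₃ := cokernel.π_desc _ _ _ }
  w₁₃ := by ext <;> exact cokernel.condition _
  h₀ := by
    apply ShortComplex.isLimitOfIsLimitπ <;>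
      apply (KernelFork.isLimitMapConeEquiv _ _).2 <;> exact kernelIsKernel _
  h₃ := by
    apply ShortComplex.isColimitOfIsColimitπ <;>
      apply (CokernelCofork.isColimitMapCoconeEquiv _ _).2 <;> exact cokernelIsCokernel _
  L₁_exact := h₁
  epi_L₁_g := inferInstance
  L₂_exact := h₂
  mono_L₂_f := inferInstance

variable {L₁ L₂ : ShortComplex 𝒜}

lemma mono_middle (h₁ : L₁.Exact) [Mono L₂.f] (φ : L₁ ⟶ L₂) [Mono φ.τ₁] [Mono φ.τ₃] :
    Mono φ.τ₂ := by
  rw [Preadditive.mono_iff_cancel_zero]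
  intro A x hx
  have hxg : x ≫ L₁.g = 0 := by
    rw [← cancel_mono φ.τ₃, zero_comp, Category.assoc, ← φ.comm₂₃, reassoc_of% hx, zero_comp]
  obtain ⟨A', π, _, y, hy⟩ := h₁.exact_up_to_refinements x hxg
  have hy₀ : y = 0 := by
    rw [← cancel_mono φ.τ₁, zero_comp, ← cancel_mono L₂.f, zero_comp, Category.assoc, φ.comm₁₂,
      ← Category.assoc, ← hy, Category.assoc, hx, comp_zero]
  rw [← cancel_epi π, hy, hy₀, zero_comp, comp_zero]

lemma cokernelRow_shortExact (h₁ : L₁.Exact) [Epi L₁.g] (h₂ : L₂.ShortExact) (φ : L₁ ⟶ L₂)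
    [Mono φ.τ₃] : (cokernelRow φ).ShortExact := by
  have := h₂.mono_f
  let S := snakeInputOfHom h₁ h₂.exact φ
  have : Epi S.L₂.g := h₂.epi_g
  have hδ : S.L₂'.f = 0 := (isZero_kernel_of_mono φ.τ₃).eq_of_src _ _
  exact { exact := S.L₃_exact, mono_f := S.L₂'_exact.mono_g hδ, epi_g := S.epi_L₃_g }

lemma mono_right_of_mono_cokernel_map (h₁ : L₁.Exact) [Epi L₁.g] (h₂ : L₂.ShortExact)
    (φ : L₁ ⟶ L₂) [Mono φ.τ₂] (hφ : Mono (cokernelRow φ).f) : Mono φ.τ₃ := by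
  have := h₂.mono_f
  let S := snakeInputOfHom h₁ h₂.exact φ
  have hg : S.L₁'.g = 0 := by
    have : Mono S.L₃.f := hφ
    exact (cancel_mono S.L₃.f).1 (S.δ_L₃_f.trans zero_comp.symm)
  have hf : S.L₁'.f = 0 := (isZero_kernel_of_mono φ.τ₂).eq_of_src _ _
  exact Preadditive.mono_of_isZero_kernel _ (S.L₁'_exact.isZero_X₂ hf hg)

lemma shortExact_cokernel {A B : 𝒜} (f : A ⟶ B) [Mono f] :
    (ShortComplex.mk f (cokernel.π f) (cokernel.condition f)).ShortExact where
  exact := ShortComplex.exact_of_g_is_cokernel _ (cokernelIsCokernel f)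

lemma shortExact_biprod (A B : 𝒜) :
    (ShortComplex.mk (biprod.inl : A ⟶ A ⊞ B) biprod.snd biprod.inl_snd).ShortExact :=
  (ShortComplex.Splitting.ofHasBinaryBiproduct A B).shortExact

/-- The third term of a short exact sequence is a cokernel of the first map. -/
def cokernelIsoOfShortExact {S : ShortComplex 𝒜} (hS : S.ShortExact) : cokernel S.f ≅ S.X₃ :=
  IsColimit.coconePointUniqueUpToIso (cokernelIsCokernel _)
    (letI := hS.epi_g; hS.exact.gIsCokernel)

@[simp]
lemma π_cokernelIsoOfShortExact_hom {S : ShortComplex 𝒜} (hS : S.ShortExact) :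
    cokernel.π S.f ≫ (cokernelIsoOfShortExact hS).hom = S.g :=
  IsColimit.comp_coconePointUniqueUpToIso_hom (cokernelIsCokernel _) _ WalkingParallelPair.one

end Snake

section Closure

variable {𝒜 : Type u} [Category.{v} 𝒜] [Abelian 𝒜]

lemma IsGorensteinProjective.of_iso {M N : 𝒜} (e : M ≅ N) (h : IsGorensteinProjective N) :
    IsGorensteinProjective M := by
  obtain ⟨P, h₁, h₂, h₃, ⟨i⟩⟩ := h
  exact ⟨P, h₁, h₂, h₃, ⟨e ≪≫ i⟩⟩

/-- `M` embeds into a projective object with cokernel satisfying `𝒢`. -/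
def EmbedsInProjective (𝒢 : 𝒜 → Prop) (M : 𝒜) : Prop :=
  ∃ (P : 𝒜) (f : M ⟶ P), Projective P ∧ Mono f ∧ 𝒢 (cokernel f)

section

variable [HasExt.{w₁} 𝒜] [EnoughProjectives 𝒜]

lemma isGorensteinProjective_of_embedsInProjective (𝒢 : 𝒜 → Prop)
    (h𝒢 : ∀ M, 𝒢 M → PerpProjective.{w₁} M) (h : ∀ M, 𝒢 M → EmbedsInProjective 𝒢 M)
    {M : 𝒜} (hM : 𝒢 M) : IsGorensteinProjective M := by
  let Rel (Y X : 𝒜) : Prop := ∃ (P : 𝒜) (f : Y ⟶ P) (g : P ⟶ X) (w : f ≫ g = 0),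
    Projective P ∧ (ShortComplex.mk f g w).ShortExact
  have hco (X : {X // 𝒢 X}) : ∃ Y : {X // 𝒢 X}, Rel X.1 Y.1 := by
    obtain ⟨P, f, hP, hf, hc⟩ := h X.1 X.2
    exact ⟨⟨_, hc⟩, P, f, cokernel.π f, _, hP, shortExact_cokernel f⟩
  have hsyz (X : {X : 𝒜 // PerpProjective.{w₁} X}) :
      ∃ Y : {X : 𝒜 // PerpProjective.{w₁} X}, Rel Y.1 X.1 := by
    have hS : (ShortComplex.mk (kernel.ι (Projective.π X.1)) (Projective.π X.1)
        (kernel.condition _)).ShortExact :=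
      ⟨ShortComplex.exact_of_f_is_kernel _ (kernelIsKernel _)⟩
    refine ⟨⟨kernel (Projective.π X.1), fun Q hQ n => ?_⟩, _, _, _, _, inferInstance, hS⟩
    exact ext_left hS Q (Abelian.Ext.subsingleton_of_projective _ Q n) (X.2 Q hQ (n + 1))
  choose co hco using hco
  choose syz hsyz using hsyz
  let Z : ℤ → 𝒜
    | Int.ofNat n => (co^[n] ⟨M, hM⟩).1
    | Int.negSucc n => (syz^[n + 1] ⟨M, h𝒢 M hM⟩).1
  have hZ : ∀ n, PerpProjective.{w₁} (Z n)
    | Int.ofNat n => h𝒢 _ (co^[n] ⟨M, hM⟩).2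
    | Int.negSucc n => (syz^[n + 1] ⟨M, h𝒢 M hM⟩).2
  have hRel : ∀ n : ℤ, Rel (Z n) (Z (n + 1))
    | Int.ofNat n => by
      have := hco (co^[n] ⟨M, hM⟩)
      rwa [← Function.iterate_succ_apply' co] at this
    | Int.negSucc 0 => hsyz _
    | Int.negSucc (n + 1) => by
      have := hsyz (syz^[n + 1] ⟨M, h𝒢 M hM⟩)
      rwa [← Function.iterate_succ_apply' syz] at this
  choose P f g w hP hS using hRel
  exact isGorensteinProjective_of_sequence Z P f g w hP hZ hS

lemma IsGorensteinProjective.embedsInProjective {M : 𝒜} (h : IsGorensteinProjective M) :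
    EmbedsInProjective IsGorensteinProjective M := by
  obtain ⟨P, h₁, h₂, h₃, ⟨e⟩⟩ := h
  have hcyc (n : ℤ) : IsGorensteinProjective (P.cycles n) := by
    refine isGorensteinProjective_of_embedsInProjective.{w₁}
      (fun N => ∃ n, Nonempty (N ≅ P.cycles n)) ?_ ?_ ⟨n, ⟨Iso.refl _⟩⟩
    · rintro N ⟨m, ⟨i⟩⟩
      exact (perpProjective_cycles ⟨h₁, h₂, h₃⟩ m).of_iso i
    · rintro N ⟨m, ⟨i⟩⟩
      exact ⟨P.X m, i.hom ≫ P.iCycles m, h₁ m, inferInstance, m + 1,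
        ⟨cokernelEpiComp i.hom _ ≪≫ cokernelIsoOfShortExact (shortExact_cycles h₂ m)⟩⟩
  exact ⟨P.X 0, e.hom ≫ P.iCycles 0, h₁ 0, inferInstance,
    (hcyc 1).of_iso (cokernelEpiComp e.hom _ ≪≫ cokernelIsoOfShortExact (shortExact_cycles h₂ 0))⟩

lemma IsGorensteinProjective.of_projective (M : 𝒜) [Projective M] : IsGorensteinProjective M :=
  isGorensteinProjective_of_embedsInProjective.{w₁} Projective
    (fun N _ => PerpProjective.of_projective N)
    (fun N hN => ⟨N, 𝟙 N, hN, inferInstance,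
      Projective.of_iso (cokernel.ofEpi (𝟙 N)).symm inferInstance⟩) ‹_›

lemma IsGorensteinProjective.of_extension {S : ShortComplex 𝒜} (hS : S.ShortExact)
    (h₁ : IsGorensteinProjective S.X₁) (h₃ : IsGorensteinProjective S.X₃) :
    IsGorensteinProjective S.X₂ := by
  refine isGorensteinProjective_of_embedsInProjective.{w₁}
    (fun E => ∃ S : ShortComplex 𝒜, S.ShortExact ∧ IsGorensteinProjective S.X₁ ∧
      IsGorensteinProjective S.X₃ ∧ S.X₂ = E) ?_ ?_ ⟨S, hS, h₁, h₃, rfl⟩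
  · rintro _ ⟨S, hS, h₁, h₃, rfl⟩ Q hQ n
    exact ext_middle hS Q (h₁.perpProjective Q hQ n) (h₃.perpProjective Q hQ n)
  · rintro _ ⟨S, hS, h₁, h₃, rfl⟩
    obtain ⟨P, a, hP, ha, hca⟩ := embedsInProjective.{w₁} h₁
    obtain ⟨R, c, hR, hc, hcc⟩ := embedsInProjective.{w₁} h₃
    have := h₃.perpProjective P hP 0
    obtain ⟨u, hu⟩ := exists_extension_of_ext_one.{w₁} hS P a
    let φ : S ⟶ ShortComplex.mk (biprod.inl : P ⟶ P ⊞ R) biprod.snd biprod.inl_snd :=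
      { τ₁ := a
        τ₂ := biprod.lift u (S.g ≫ c)
        τ₃ := c
        comm₁₂ := by ext <;> simp [hu] }
    have := hS.epi_g
    have : Mono φ.τ₁ := ha
    have : Mono φ.τ₃ := hc
    have : Mono (ShortComplex.mk (biprod.inl : P ⟶ P ⊞ R) biprod.snd biprod.inl_snd).f :=
      (shortExact_biprod P R).mono_f
    exact ⟨P ⊞ R, φ.τ₂, inferInstance, mono_middle hS.exact φ, cokernelRow φ,
      cokernelRow_shortExact hS.exact (shortExact_biprod P R) φ, hca, hcc, rfl⟩

lemma isGorensteinProjective_of_mono {M P : 𝒜} [Projective P] (f : M ⟶ P) [Mono f]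
    (hM : PerpProjective.{w₁} M) (hf : IsGorensteinProjective (cokernel f)) :
    IsGorensteinProjective M := by
  refine isGorensteinProjective_of_embedsInProjective.{w₁}
    (fun E => IsGorensteinProjective E ∨ E = M) ?_ ?_ (Or.inr rfl)
  · rintro E (hE | rfl)
    · exact hE.perpProjective
    · exact hM
  · rintro E (hE | rfl)
    · obtain ⟨P, a, hP, ha, hca⟩ := IsGorensteinProjective.embedsInProjective.{w₁} hE
      exact ⟨P, a, hP, ha, Or.inl hca⟩
    · exact ⟨P, f, inferInstance, inferInstance, Or.inl hf⟩

lemma IsGorensteinProjective.of_kernel {S : ShortComplex 𝒜} (hS : S.ShortExact)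
    (h₂ : IsGorensteinProjective S.X₂) (h₃ : IsGorensteinProjective S.X₃) :
    IsGorensteinProjective S.X₁ := by
  obtain ⟨P, a, hP, ha, hca⟩ := embedsInProjective.{w₁} h₂
  have := hS.mono_f
  refine isGorensteinProjective_of_mono.{w₁} (S.f ≫ a) (fun Q hQ n =>
    ext_left hS Q (h₂.perpProjective Q hQ n) (h₃.perpProjective Q hQ (n + 1))) ?_
  let L : ShortComplex 𝒜 := ShortComplex.mk (𝟙 S.X₁) (0 : _ ⟶ (0 : 𝒜)) (by simp)
  let φ : L ⟶ ShortComplex.mk a (cokernel.π a) (cokernel.condition a) :=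
    { τ₁ := S.f
      τ₂ := S.f ≫ a
      τ₃ := 0 }
  have hL : L.Exact := L.exact_of_f_is_kernel (KernelFork.IsLimit.ofId _ rfl)
  have : Epi L.g := ⟨fun _ _ _ => (isZero_zero 𝒜).eq_of_src _ _⟩
  have : Mono φ.τ₃ := ⟨fun _ _ _ => (isZero_zero 𝒜).eq_of_tgt _ _⟩
  exact of_extension.{w₁} (cokernelRow_shortExact hL (shortExact_cokernel a) φ)
    (h₃.of_iso (cokernelIsoOfShortExact hS)) (hca.of_iso cokernelZeroIsoTarget)

lemma IsGorensteinProjective.of_retract {A M : 𝒜} (ρ : Retract A M)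
    (hM : IsGorensteinProjective M) : IsGorensteinProjective A := by
  refine isGorensteinProjective_of_embedsInProjective.{w₁}
    (fun A => ∃ M, IsGorensteinProjective M ∧ Nonempty (Retract A M)) ?_ ?_ ⟨M, hM, ⟨ρ⟩⟩
  · rintro A ⟨M, hM, ⟨ρ⟩⟩ Q hQ n
    exact ext_of_retract ρ Q (hM.perpProjective Q hQ n)
  · rintro A ⟨M, hM, ⟨ρ⟩⟩
    obtain ⟨P, j, hP, hj, hcj⟩ := embedsInProjective.{w₁} hM
    let s : M ⟶ P ⊞ M := biprod.lift j (𝟙 M - ρ.r ≫ ρ.i)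
    have hs : ρ.i ≫ s = ρ.i ≫ j ≫ biprod.inl := by
      ext <;> simp [s]
    let L : ShortComplex 𝒜 := ShortComplex.mk (0 : (0 : 𝒜) ⟶ _) (𝟙 M) (by simp)
    let L' : ShortComplex 𝒜 :=
      ShortComplex.mk (biprod.inr : M ⟶ P ⊞ M) biprod.fst biprod.inr_fst
    have hL' : L'.ShortExact :=
      ShortComplex.Splitting.shortExact { r := biprod.snd, s := biprod.inl }
    have hL : L.Exact := L.exact_of_g_is_cokernel (CokernelCofork.IsColimit.ofId _ rfl)
    let φ : L ⟶ L' := { τ₁ := 0, τ₂ := s, τ₃ := j }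
    have : Mono φ.τ₃ := hj
    have : Epi L.g := inferInstanceAs (Epi (𝟙 M))
    have hN : IsGorensteinProjective (cokernel s) :=
      of_extension.{w₁} (cokernelRow_shortExact hL hL' φ) (hM.of_iso cokernelZeroIsoTarget) hcj
    refine ⟨P, ρ.i ≫ j, hP, inferInstance, cokernel s, hN, ⟨?_⟩⟩
    exact
      { i := cokernel.desc _ (biprod.inl ≫ cokernel.π s) (by
          rw [Category.assoc, ← reassoc_of% hs, cokernel.condition, comp_zero])
        r := cokernel.desc _ (biprod.desc (cokernel.π _) (-(j ≫ cokernel.π _))) (by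
          have := cokernel.condition (ρ.i ≫ j)
          rw [Category.assoc] at this
          simp [s, this]) }

end

end Closure

section RightExact

variable {𝒜 : Type u} [Category.{v} 𝒜] [Abelian 𝒜] {ℬ : Type u'} [Category.{v'} ℬ] [Abelian ℬ]
  (T : ℬ ⥤ 𝒜) [PreservesFiniteColimits T]

lemma map_exact_of_epi {S : ShortComplex ℬ}
    (hS : S.Exact) [Epi S.g] : (S.map T).Exact :=
  have := preservesBinaryBiproducts_of_preservesBinaryCoproducts T
  have : T.Additive := T.additive_of_preservesBinaryBiproducts
  ((T.preservesFiniteColimits_tfae.out 3 1 rfl rfl).1 ‹_› S ⟨hS, inferInstance⟩).1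

lemma exact_up_to_refinements_map {X Y Z : ℬ} {f : X ⟶ Y} {g : Y ⟶ Z} {w : f ≫ g = 0}
    (h : (ShortComplex.mk f g w).Exact) [Epi g] {A : 𝒜} (x : A ⟶ T.obj Y)
    (hx : x ≫ T.map g = 0) :
    ∃ (A' : 𝒜) (π : A' ⟶ A) (_ : Epi π) (y : A' ⟶ T.obj X), π ≫ x = y ≫ T.map f :=
  have : Epi (ShortComplex.mk f g w).g := ‹Epi g›
  (map_exact_of_epi T h).exact_up_to_refinements x hx

variable [T.Additive]

lemma mono_map_iCycles (hT : CompatibleC1 T) {P : CochainComplex ℬ ℤ}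
    (hP : ∀ n, Projective (P.X n)) (hP' : ∀ n, P.ExactAt n) (n : ℤ) :
    Mono (T.map (P.iCycles n)) := by
  obtain ⟨m, rfl⟩ : ∃ m, n = m + 1 + 1 := ⟨n - 1 - 1, by ring⟩
  have hT' := (exactAt_succ_iff _ m).1 (hT P hP hP' (m + 1))
  have : Epi (P.toCycles (m + 1) (m + 1 + 1)) := (shortExact_cycles hP' (m + 1)).epi_g
  rw [Preadditive.mono_iff_cancel_zero]
  intro A x hx
  obtain ⟨A₁, π₁, _, y, hy⟩ :=
    surjective_up_to_refinements_of_epi (T.map (P.toCycles (m + 1) (m + 1 + 1))) x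
  obtain ⟨A₂, π₂, _, (z : A₂ ⟶ T.obj (P.X m)), hz⟩ := hT'.exact_up_to_refinements y (by
    change y ≫ T.map (P.d _ _) = 0
    rw [← P.toCycles_i, T.map_comp, ← Category.assoc, ← hy, Category.assoc, hx, comp_zero])
  change π₂ ≫ y = z ≫ T.map (P.d _ _) at hz
  rw [← cancel_epi π₁, ← cancel_epi π₂, hy, reassoc_of% hz, ← T.map_comp, P.d_toCycles]
  simp

/-- A functor satisfying (C1) keeps the first map of a short exact sequence monic when the
last term is Gorenstein projective. -/
lemma mono_map_of_isGorensteinProjective (hT : CompatibleC1 T) {S : ShortComplex ℬ}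
    (hS : S.ShortExact) (h₃ : IsGorensteinProjective S.X₃) : Mono (T.map S.f) := by
  obtain ⟨P, h, h', n, ⟨e⟩⟩ : ∃ P : CochainComplex ℬ ℤ, (∀ n, Projective (P.X n)) ∧
      (∀ n, P.ExactAt n) ∧ ∃ n, Nonempty (S.X₃ ≅ P.cycles (n + 1)) := by
    obtain ⟨P, h, h', -, e⟩ := h₃
    exact ⟨P, h, h', -1, by simpa using e⟩
  have := hS.mono_f
  have := hS.epi_g
  have := h n
  have := mono_map_iCycles T hT h h' n
  let Z : ShortComplex ℬ := ShortComplex.mk (P.iCycles n) (P.toCycles n (n + 1))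
    (by simp [← cancel_mono (P.iCycles (n + 1))])
  have hZ : Z.ShortExact := shortExact_cycles h' n
  let q : P.X n ⟶ S.X₃ := P.toCycles n (n + 1) ≫ e.inv
  have hq : P.iCycles n ≫ q = 0 := by
    rw [← cancel_mono e.hom, ← cancel_mono (P.iCycles (n + 1))]
    simp [q]
  let i : ShortComplex.mk _ _ hq ≅ Z :=
    ShortComplex.isoMk (Iso.refl _) (Iso.refl _) e (by simp [Z]) (by simp [q, Z])
  have hPq : (ShortComplex.mk _ _ hq).Exact := (ShortComplex.exact_iff_of_iso i).2 hZ.exact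
  have : Epi q := epi_comp' hZ.epi_g inferInstance
  obtain ⟨l, hl⟩ : ∃ l : P.X n ⟶ S.X₂, l ≫ S.g = q := ⟨_, Projective.factorThru_comp q S.g⟩
  let k : P.cycles n ⟶ S.X₁ := hS.exact.lift (P.iCycles n ≫ l) (by simp [hl, hq])
  have hk : k ≫ S.f = P.iCycles n ≫ l := hS.exact.lift_f _ _
  have w : biprod.lift (P.iCycles n) (-k) ≫ biprod.desc l S.f = 0 := by simp [hk]
  have hL : (ShortComplex.mk _ _ w).Exact := by
    rw [ShortComplex.exact_iff_exact_up_to_refinements]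
    intro A (x : A ⟶ P.X n ⊞ S.X₁) hx
    replace hx : (x ≫ biprod.fst) ≫ l = - (x ≫ biprod.snd) ≫ S.f := by
      rw [← add_eq_zero_iff_eq_neg']
      simpa [biprod.desc_eq, add_comm] using hx
    obtain ⟨A', π, _, z, hz⟩ := hPq.exact_up_to_refinements (x ≫ biprod.fst) (by
      have := hx =≫ S.g
      simpa [hl] using this)
    refine ⟨A', π, inferInstance, z, ?_⟩
    dsimp at hz
    have hz' := π ≫= hx
    apply biprod.hom_ext
    · simpa using hz
    · rw [← cancel_mono S.f, ← neg_inj]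
      simp only [Category.assoc, Preadditive.comp_neg] at hz' hz ⊢
      simp [← hz', reassoc_of% hz, hk]
  have : Epi (biprod.desc l S.f) := by
    rw [epi_iff_surjective_up_to_refinements]
    intro A y
    obtain ⟨A', π, _, p, hp⟩ := surjective_up_to_refinements_of_epi q (y ≫ S.g)
    let a := hS.exact.lift (π ≫ y - p ≫ l) (by simp [hl, hp])
    have ha : a ≫ S.f = π ≫ y - p ≫ l := hS.exact.lift_f _ _
    exact ⟨A', π, inferInstance, biprod.lift p a, by simp [ha]⟩
  rw [Preadditive.mono_iff_cancel_zero]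
  intro A x hx
  obtain ⟨A', π, _, y, hy⟩ := exact_up_to_refinements_map T hL (x ≫ T.map biprod.inr) (by
    rw [Category.assoc, ← T.map_comp, biprod.inr_desc, hx])
  have hy₀ : y = 0 := by
    rw [← cancel_mono (T.map (P.iCycles n)), zero_comp]
    have := hy =≫ T.map biprod.fst
    simpa [← T.map_comp] using this.symm
  have := hy =≫ T.map biprod.snd
  rw [hy₀] at this
  rw [← cancel_epi π, comp_zero]
  simpa [← T.map_comp] using this

end RightExact

section CommaMono

variable {𝒜 : Type u} [Category.{v} 𝒜] {ℬ : Type u'} [Category.{v'} ℬ] {T : ℬ ⥤ 𝒜}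

lemma mono_of_mono_left_right {X Y : Comma T (𝟭 𝒜)} (f : X ⟶ Y) [Mono f.left] [Mono f.right] :
    Mono f where
  right_cancellation _ _ h := by
    ext
    · rw [← cancel_mono f.left]
      exact congr_arg CommaMorphism.left h
    · rw [← cancel_mono f.right]
      exact congr_arg CommaMorphism.right h

lemma epi_of_epi_left_right {X Y : Comma T (𝟭 𝒜)} (f : X ⟶ Y) [Epi f.left] [Epi f.right] :
    Epi f where
  left_cancellation _ _ h := by
    ext
    · rw [← cancel_epi f.left]
      exact congr_arg CommaMorphism.left h
    · rw [← cancel_epi f.right]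
      exact congr_arg CommaMorphism.right h

end CommaMono

section CommaLimits

variable {𝒜 : Type u} [Category.{v} 𝒜] [Abelian 𝒜] {ℬ : Type u'} [Category.{v'} ℬ] [Abelian ℬ]
  (T : ℬ ⥤ 𝒜)

instance preservesFiniteLimits_fst : PreservesFiniteLimits (Comma.fst T (𝟭 𝒜)) where
  preservesFiniteLimits _ _ _ :=
    { preservesLimit := preservesLimit_of_preserves_limit_cone
        (Comma.coneOfPreservesIsLimit _ (limit.isLimit _) (limit.isLimit _)) (limit.isLimit _) }

instance preservesFiniteLimits_snd : PreservesFiniteLimits (Comma.snd T (𝟭 𝒜)) where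
  preservesFiniteLimits _ _ _ :=
    { preservesLimit := preservesLimit_of_preserves_limit_cone
        (Comma.coneOfPreservesIsLimit _ (limit.isLimit _) (limit.isLimit _)) (limit.isLimit _) }

instance preservesFiniteColimits_fst [PreservesFiniteColimits T] :
    PreservesFiniteColimits (Comma.fst T (𝟭 𝒜)) where
  preservesFiniteColimits _ _ _ := inferInstance

instance preservesFiniteColimits_snd [PreservesFiniteColimits T] :
    PreservesFiniteColimits (Comma.snd T (𝟭 𝒜)) where
  preservesFiniteColimits _ _ _ := inferInstance

end CommaLimits

section CommaRow

variable {𝒜 : Type u} [Category.{v} 𝒜] [Abelian 𝒜] {ℬ : Type u'} [Category.{v'} ℬ] [Abelian ℬ]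
  {T : ℬ ⥤ 𝒜} [PreservesFiniteColimits T] [Abelian (Comma T (𝟭 𝒜))]

/-- A short complex in the comma category, seen as a morphism of short complexes. -/
@[simps]
def commaRow (S : ShortComplex (Comma T (𝟭 𝒜))) :
    (S.map (Comma.fst T (𝟭 𝒜))).map T ⟶ S.map (Comma.snd T (𝟭 𝒜)) where
  τ₁ := S.X₁.hom
  τ₂ := S.X₂.hom
  τ₃ := S.X₃.hom
  comm₁₂ := S.f.w.symm
  comm₂₃ := S.g.w.symm

variable {S : ShortComplex (Comma T (𝟭 𝒜))}

lemma shortExact_left (hS : S.ShortExact) : (S.map (Comma.fst T (𝟭 𝒜))).ShortExact :=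
  hS.map_of_exact _

lemma shortExact_right (hS : S.ShortExact) : (S.map (Comma.snd T (𝟭 𝒜))).ShortExact :=
  hS.map_of_exact _

lemma exact_map_left (hS : S.ShortExact) : ((S.map (Comma.fst T (𝟭 𝒜))).map T).Exact :=
  have := (shortExact_left hS).epi_g
  map_exact_of_epi T (shortExact_left hS).exact

lemma epi_map_left (hS : S.ShortExact) : Epi ((S.map (Comma.fst T (𝟭 𝒜))).map T).g :=
  have := (shortExact_left hS).epi_g
  inferInstanceAs (Epi (T.map (S.map (Comma.fst T (𝟭 𝒜))).g))

end CommaRow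

section CommaRetract

variable {𝒜 : Type u} [Category.{v} 𝒜] {ℬ : Type u'} [Category.{v'} ℬ] {T : ℬ ⥤ 𝒜}
  {W Z : Comma T (𝟭 𝒜)}

/-- A retract of an object with monic structure map has monic structure map. -/
lemma mono_hom_of_retract (ρ : Retract W Z) [Mono Z.hom] : Mono W.hom := by
  have hρ : T.map ρ.i.left ≫ T.map ρ.r.left = 𝟙 _ := by
    rw [← T.map_comp, ← Comma.comp_left, ρ.retract, Comma.id_left, T.map_id]
  have : Mono (T.map ρ.i.left) := mono_of_mono_fac hρ
  have h : W.hom ≫ ρ.i.right = T.map ρ.i.left ≫ Z.hom := ρ.i.w.symm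
  have : Mono (W.hom ≫ ρ.i.right) := h ▸ mono_comp _ _
  exact mono_of_mono W.hom ρ.i.right

/-- The retract of cokernels of structure maps. -/
def cokernelRetract [Abelian 𝒜] (ρ : Retract W Z) :
    Retract (cokernel W.hom) (cokernel Z.hom) where
  i := cokernel.map W.hom Z.hom (T.map ρ.i.left) ρ.i.right ρ.i.w.symm
  r := cokernel.map Z.hom W.hom (T.map ρ.r.left) ρ.r.right ρ.r.w.symm
  retract := by
    have h : ρ.i.right ≫ ρ.r.right = 𝟙 _ := by
      rw [← Comma.comp_right, ρ.retract, Comma.id_right]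
    apply coequalizer.hom_ext
    rw [Category.comp_id]
    erw [cokernel.π_desc_assoc, Category.assoc, cokernel.π_desc, ← Category.assoc, h]
    exact Category.id_comp _

end CommaRetract

section CommaClass

variable {𝒜 : Type u} [Category.{v} 𝒜] [Abelian 𝒜] {ℬ : Type u'} [Category.{v'} ℬ]
  {T : ℬ ⥤ 𝒜}

variable (T) in
/-- The objects with projective source and monic structure map with projective cokernel. -/
abbrev projectiveClass : Set (Comma T (𝟭 𝒜)) :=
  CommaClass T {M : 𝒜 | Projective M} {M : ℬ | Projective M}

variable {W Z : Comma T (𝟭 𝒜)}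

lemma mem_projectiveClass_iff : Z ∈ projectiveClass T ↔
    Projective Z.left ∧ Mono Z.hom ∧ Projective (cokernel Z.hom) :=
  and_congr_right fun _ => and_congr_right fun _ =>
    ⟨fun ⟨_, hX, ⟨e⟩⟩ => Projective.of_iso e hX, fun h => ⟨_, h, ⟨Iso.refl _⟩⟩⟩

/-- The object `T Q ⟶ T Q ⊞ R` of the comma category. -/
def biprodObj (T : ℬ ⥤ 𝒜) (Q : ℬ) (R : 𝒜) : Comma T (𝟭 𝒜) where
  left := Q
  right := T.obj Q ⊞ R
  hom := biprod.inl

lemma biprodObj_mem_projectiveClass (Q : ℬ) (R : 𝒜) [Projective Q] [Projective R] :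
    biprodObj T Q R ∈ projectiveClass T :=
  ⟨‹_›, (shortExact_biprod (T.obj Q) R).mono_f, R, ‹_›,
    ⟨(cokernelIsoOfShortExact (shortExact_biprod (T.obj Q) R)).symm⟩⟩

lemma projectiveClass_of_retract (ρ : Retract W Z) (hZ : Z ∈ projectiveClass T) :
    W ∈ projectiveClass T := by
  rw [mem_projectiveClass_iff] at hZ ⊢
  obtain ⟨h₁, _, h₂⟩ := hZ
  have : Projective ((Comma.fst T (𝟭 𝒜)).obj Z) := h₁
  exact ⟨(ρ.map (Comma.fst _ _)).projective, mono_hom_of_retract ρ, (cokernelRetract ρ).projective⟩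

variable [Abelian ℬ]

/-- Objects of `projectiveClass T` are projective. -/
lemma projective_of_mem_projectiveClass [PreservesFiniteColimits T] (hZ : Z ∈ projectiveClass T) :
    Projective Z := by
  obtain ⟨_, _, _⟩ := mem_projectiveClass_iff.1 hZ
  let z : T.obj Z.left ⟶ Z.right := Z.hom
  have : Mono z := ‹Mono Z.hom›
  have : Projective (ShortComplex.mk z (cokernel.π z) (cokernel.condition _)).X₃ :=
    ‹Projective (cokernel Z.hom)›
  obtain ⟨r, s, fr, sg, id⟩ := (shortExact_cokernel z).splittingOfProjective
  dsimp at r s fr sg id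
  refine ⟨fun {M N} f g hg => ?_⟩
  have : Epi g.left := inferInstanceAs (Epi ((Comma.fst T (𝟭 𝒜)).map g))
  have : Epi g.right := inferInstanceAs (Epi ((Comma.snd T (𝟭 𝒜)).map g))
  let b := Projective.factorThru f.left g.left
  have hb : b ≫ g.left = f.left := Projective.factorThru_comp _ _
  let c : cokernel z ⟶ M.right := Projective.factorThru (s ≫ f.right) g.right
  have hc : c ≫ g.right = s ≫ f.right := Projective.factorThru_comp _ _
  let m : T.obj M.left ⟶ M.right := M.hom
  let n : T.obj N.left ⟶ N.right := N.hom
  have hf : T.map f.left ≫ n = z ≫ f.right := f.w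
  have hg' : T.map g.left ≫ n = m ≫ g.right := g.w
  let a : Z.right ⟶ M.right := r ≫ T.map b ≫ m + cokernel.π z ≫ c
  have hza : z ≫ a = T.map b ≫ m := by
    rw [Preadditive.comp_add, reassoc_of% fr, cokernel.condition_assoc, zero_comp, add_zero]
  have hag : a ≫ g.right = f.right := by
    rw [Preadditive.add_comp, Category.assoc, Category.assoc, Category.assoc, hc, ← hg',
      ← T.map_comp_assoc, hb, hf, ← Category.assoc, ← Category.assoc, ← Preadditive.add_comp, id,
      Category.id_comp]
  refine ⟨{ left := b, right := a, w := hza.symm }, ?_⟩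
  ext
  · exact hb
  · exact hag

variable (T) in
/-- The objects with Gorenstein projective source and monic structure map with Gorenstein
projective cokernel. -/
abbrev gorensteinClass : Set (Comma T (𝟭 𝒜)) :=
  CommaClass T {M : 𝒜 | IsGorensteinProjective M} {M : ℬ | IsGorensteinProjective M}

lemma mem_gorensteinClass_iff : Z ∈ gorensteinClass T ↔
    IsGorensteinProjective Z.left ∧ Mono Z.hom ∧ IsGorensteinProjective (cokernel Z.hom) :=
  and_congr_right fun _ => and_congr_right fun _ =>
    ⟨fun ⟨_, hX, ⟨e⟩⟩ => IsGorensteinProjective.of_iso e.symm hX, fun h => ⟨_, h, ⟨Iso.refl _⟩⟩⟩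

variable [EnoughProjectives 𝒜] [EnoughProjectives ℬ] [HasExt.{w₁} 𝒜] [HasExt.{w₂} ℬ]

lemma gorensteinClass_of_retract (ρ : Retract W Z) (hZ : Z ∈ gorensteinClass T) :
    W ∈ gorensteinClass T := by
  rw [mem_gorensteinClass_iff] at hZ ⊢
  obtain ⟨h₁, _, h₂⟩ := hZ
  exact ⟨h₁.of_retract.{w₂} (ρ.map (Comma.fst _ _)), mono_hom_of_retract ρ,
    h₂.of_retract.{w₁} (cokernelRetract ρ)⟩

lemma projectiveClass_subset : projectiveClass T ⊆ gorensteinClass T := by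
  intro Z hZ
  obtain ⟨_, h, _⟩ := mem_projectiveClass_iff.1 hZ
  exact mem_gorensteinClass_iff.2 ⟨.of_projective.{w₂} _, h, .of_projective.{w₁} _⟩

end CommaClass

section CommaClosure

variable {𝒜 : Type u} [Category.{v} 𝒜] [Abelian 𝒜] [EnoughProjectives 𝒜] [HasExt.{w₁} 𝒜]
  {ℬ : Type u'} [Category.{v'} ℬ] [Abelian ℬ] [EnoughProjectives ℬ] [HasExt.{w₂} ℬ]
  {T : ℬ ⥤ 𝒜} [PreservesFiniteColimits T] [Abelian (Comma T (𝟭 𝒜))]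

lemma gorensteinClass_of_extension {S : ShortComplex (Comma T (𝟭 𝒜))} (hS : S.ShortExact)
    (h₁ : S.X₁ ∈ gorensteinClass T) (h₃ : S.X₃ ∈ gorensteinClass T) :
    S.X₂ ∈ gorensteinClass T := by
  rw [mem_gorensteinClass_iff] at h₁ h₃ ⊢
  have := epi_map_left hS
  have := (shortExact_right hS).mono_f
  have : Mono (commaRow S).τ₁ := h₁.2.1
  have : Mono (commaRow S).τ₃ := h₃.2.1
  exact ⟨.of_extension.{w₂} (shortExact_left hS) h₁.1 h₃.1,
    mono_middle (exact_map_left hS) (commaRow S),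
    .of_extension.{w₁} (cokernelRow_shortExact (exact_map_left hS) (shortExact_right hS)
      (commaRow S)) h₁.2.2 h₃.2.2⟩

lemma gorensteinClass_of_kernel
    (hT : ∀ S : ShortComplex ℬ, S.ShortExact → IsGorensteinProjective S.X₃ → Mono (T.map S.f))
    {S : ShortComplex (Comma T (𝟭 𝒜))} (hS : S.ShortExact)
    (h₂ : S.X₂ ∈ gorensteinClass T) (h₃ : S.X₃ ∈ gorensteinClass T) :
    S.X₁ ∈ gorensteinClass T := by
  rw [mem_gorensteinClass_iff] at h₂ h₃ ⊢
  have := epi_map_left hS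
  have : Mono (T.map S.f.left) := hT _ (shortExact_left hS) h₃.1
  have : Mono S.X₂.hom := h₂.2.1
  have : Mono (commaRow S).τ₃ := h₃.2.1
  have h : S.X₁.hom ≫ S.f.right = T.map S.f.left ≫ S.X₂.hom := S.f.w.symm
  have : Mono (S.X₁.hom ≫ S.f.right) := h ▸ mono_comp _ _
  exact ⟨.of_kernel.{w₂} (shortExact_left hS) h₂.1 h₃.1, mono_of_mono S.X₁.hom S.f.right,
    .of_kernel.{w₁} (cokernelRow_shortExact (exact_map_left hS) (shortExact_right hS)
      (commaRow S)) h₂.2.2 h₃.2.2⟩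

lemma exists_generator
    (hT : ∀ S : ShortComplex ℬ, S.ShortExact → IsGorensteinProjective S.X₃ → Mono (T.map S.f))
    (X : Comma T (𝟭 𝒜)) (hX : X ∈ gorensteinClass T) :
    ∃ S : ShortComplex (Comma T (𝟭 𝒜)), S.ShortExact ∧ S.X₃ = X ∧ S.X₂ ∈ projectiveClass T ∧
      S.X₁ ∈ gorensteinClass T := by
  let x : T.obj X.left ⟶ X.right := X.hom
  let V := biprodObj T (Projective.over X.left) (Projective.over X.right)
  let q : V ⟶ X :=
    { left := Projective.π X.left
      right := biprod.desc (T.map (Projective.π X.left) ≫ x) (Projective.π X.right)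
      w := (biprod.inl_desc _ _).symm }
  have hV : V ∈ projectiveClass T := biprodObj_mem_projectiveClass _ _
  have : Epi q.left := inferInstanceAs (Epi (Projective.π X.left))
  have : Epi q.right := by
    have h : biprod.inr ≫ q.right = Projective.π X.right := biprod.inr_desc _ _
    have : Epi ((biprod.inr : _ ⟶ T.obj (Projective.over X.left) ⊞ _) ≫ q.right) := by
      rw [h]; infer_instance
    exact epi_of_epi biprod.inr q.right
  have : Epi q := epi_of_epi_left_right q
  have hS : (ShortComplex.mk (kernel.ι q) q (kernel.condition q)).ShortExact :=
    { exact := ShortComplex.exact_of_f_is_kernel _ (kernelIsKernel q) }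
  exact ⟨_, hS, rfl, hV,
    gorensteinClass_of_kernel.{w₁, w₂} hT hS (projectiveClass_subset.{w₁, w₂} hV) hX⟩

lemma exists_cogenerator
    (hT : ∀ S : ShortComplex ℬ, S.ShortExact → IsGorensteinProjective S.X₃ → Mono (T.map S.f))
    (hP : ∀ Q : ℬ, Projective Q → Projective (T.obj Q))
    (X : Comma T (𝟭 𝒜)) (hX : X ∈ gorensteinClass T) :
    ∃ S : ShortComplex (Comma T (𝟭 𝒜)), S.ShortExact ∧ S.X₁ = X ∧ S.X₂ ∈ projectiveClass T ∧
      S.X₃ ∈ gorensteinClass T := by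
  obtain ⟨hB, _, hC⟩ := mem_gorensteinClass_iff.1 hX
  let x : T.obj X.left ⟶ X.right := X.hom
  have : Mono x := ‹Mono X.hom›
  obtain ⟨Q, j, hQ, _, hj⟩ := hB.embedsInProjective.{w₂}
  obtain ⟨R, κ, hR, _, hκ⟩ := hC.embedsInProjective.{w₁}
  change cokernel x ⟶ R at κ
  have : Subsingleton (Abelian.Ext.{w₁}
      (ShortComplex.mk x (cokernel.π x) (cokernel.condition x)).X₃ (T.obj Q) 1) :=
    hC.perpProjective.{w₁} _ (hP Q hQ) 0
  obtain ⟨t, ht⟩ := exists_extension_of_ext_one (shortExact_cokernel x) (T.obj Q) (T.map j)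
  dsimp at t ht
  let W := biprodObj T Q R
  let y : X.right ⟶ T.obj Q ⊞ R := biprod.lift t (cokernel.π x ≫ κ)
  have hy : x ≫ y = T.map j ≫ biprod.inl := by
    ext <;> simp [y, ht]
  let f : X ⟶ W := { left := j, right := y, w := hy.symm }
  let φ : ShortComplex.mk x (cokernel.π x) (cokernel.condition x) ⟶
      ShortComplex.mk (biprod.inl : T.obj Q ⟶ T.obj Q ⊞ R) biprod.snd biprod.inl_snd :=
    { τ₁ := T.map j
      τ₂ := y
      τ₃ := κ
      comm₁₂ := hy.symm
      comm₂₃ := biprod.lift_snd _ _ }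
  have hTj : Mono φ.τ₁ := hT _ (shortExact_cokernel j) hj
  have hφ₃ : Mono φ.τ₃ := ‹Mono κ›
  have hin := (shortExact_biprod (T.obj Q) R).mono_f
  have : Mono f.left := ‹Mono j›
  have : Mono f.right := mono_middle (shortExact_cokernel x).exact φ
  have : Mono f := mono_of_mono_left_right f
  let S := ShortComplex.mk f (cokernel.π f) (cokernel.condition f)
  have hS : S.ShortExact := shortExact_cokernel f
  refine ⟨_, hS, rfl, biprodObj_mem_projectiveClass Q R, ?_⟩
  have := epi_map_left hS
  have hM : Mono (commaRow S).τ₂ := hin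
  let m := cokernel.map x (biprod.inl : T.obj Q ⟶ T.obj Q ⊞ R) (T.map j) y hy
  let i := cokernelIsoOfShortExact (shortExact_biprod (T.obj Q) R)
  have hcomm : m ≫ i.hom = κ := by
    rw [← cancel_epi (cokernel.π x)]
    simp only [m, i, cokernel.π_desc_assoc, Category.assoc]
    have := π_cokernelIsoOfShortExact_hom (shortExact_biprod (T.obj Q) R)
    dsimp at this
    rw [this]
    simp [y]
  have hm : Mono m := mono_of_mono_fac hcomm
  have hS₃ : Mono (commaRow S).τ₃ :=
    mono_right_of_mono_cokernel_map (exact_map_left hS) (shortExact_right hS) (commaRow S) hm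
  exact mem_gorensteinClass_iff.2 ⟨hj.of_iso (cokernelIsoOfShortExact (shortExact_left hS)).symm,
    hS₃, hκ.of_iso ((cokernelIsoOfShortExact (cokernelRow_shortExact (exact_map_left hS)
      (shortExact_right hS) (commaRow S))).symm ≪≫ (cokernelCompIsIso m i.hom).symm ≪≫
      cokernelIsoOfEq hcomm)⟩

end CommaClosure

section CommaPerp

variable {𝒜 : Type u} [Category.{v} 𝒜] [Abelian 𝒜] [EnoughProjectives 𝒜] [HasExt.{w₁} 𝒜]
  {ℬ : Type u'} [Category.{v'} ℬ] [Abelian ℬ] [HasExt.{w₂} ℬ]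
  {T : ℬ ⥤ 𝒜} [PreservesFiniteColimits T] [Abelian (Comma T (𝟭 𝒜))]

/-- Morphisms into an object of `projectiveClass T` extend along monomorphisms with cokernel in
`gorensteinClass T`. -/
lemma exists_extension_of_mem_gorensteinClass
    (hP : ∀ Q : ℬ, Projective Q → Projective (T.obj Q))
    (hGP : ∀ G : ℬ, IsGorensteinProjective G → IsGorensteinProjective (T.obj G))
    {S : ShortComplex (Comma T (𝟭 𝒜))} (hS : S.ShortExact) (h₃ : S.X₃ ∈ gorensteinClass T)
    {W : Comma T (𝟭 𝒜)} (hW : W ∈ projectiveClass T) (a : S.X₁ ⟶ W) : ∃ b, S.f ≫ b = a := by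
  obtain ⟨hB, _, hC⟩ := mem_gorensteinClass_iff.1 h₃
  obtain ⟨_, _, _⟩ := mem_projectiveClass_iff.1 hW
  have hφ := shortExact_cokernel (show T.obj S.X₃.left ⟶ S.X₃.right from S.X₃.hom)
  have hA : IsGorensteinProjective S.X₃.right := .of_extension.{w₁} hφ (hGP _ hB) hC
  have hWr : Projective W.right := by
    have : Projective (T.obj W.left) := hP _ ‹_›
    have hw := shortExact_cokernel (show T.obj W.left ⟶ W.right from W.hom)
    have : Projective (ShortComplex.mk (show T.obj W.left ⟶ W.right from W.hom)
      (cokernel.π _) (cokernel.condition _)).X₃ := ‹_›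
    exact Projective.of_iso hw.splittingOfProjective.isoBinaryBiproduct.symm
      (inferInstanceAs (Projective (T.obj W.left ⊞ cokernel W.hom)))
  let x₁ : T.obj S.X₁.left ⟶ S.X₁.right := S.X₁.hom
  let x₂ : T.obj S.X₂.left ⟶ S.X₂.right := S.X₂.hom
  let x₃ : T.obj S.X₃.left ⟶ S.X₃.right := S.X₃.hom
  let z : T.obj W.left ⟶ W.right := W.hom
  have hf : T.map S.f.left ≫ x₂ = x₁ ≫ S.f.right := S.f.w
  have hg : T.map S.g.left ≫ x₃ = x₂ ≫ S.g.right := S.g.w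
  have ha : T.map a.left ≫ z = x₁ ≫ a.right := a.w
  have hfg : S.f.right ≫ S.g.right = 0 := (S.map (Comma.snd T (𝟭 𝒜))).zero
  have : Subsingleton (Abelian.Ext.{w₂} (S.map (Comma.fst T (𝟭 𝒜))).X₃ W.left 1) :=
    hB.perpProjective.{w₂} _ ‹_› 0
  obtain ⟨b, hb⟩ := exists_extension_of_ext_one (shortExact_left hS) W.left a.left
  change S.X₂.left ⟶ W.left at b
  change S.f.left ≫ b = a.left at hb
  have : Subsingleton (Abelian.Ext.{w₁} (S.map (Comma.snd T (𝟭 𝒜))).X₃ W.right 1) :=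
    hA.perpProjective.{w₁} _ ‹_› 0
  obtain ⟨α, hα⟩ := exists_extension_of_ext_one (shortExact_right hS) W.right a.right
  change S.X₂.right ⟶ W.right at α
  change S.f.right ≫ α = a.right at hα
  have := epi_map_left hS
  have hδ : T.map S.f.left ≫ (x₂ ≫ α - T.map b ≫ z) = 0 := by
    rw [Preadditive.comp_sub, reassoc_of% hf, hα, ← T.map_comp_assoc, hb, ha, sub_self]
  obtain ⟨δ, hδ'⟩ : ∃ δ : T.obj S.X₃.left ⟶ W.right,
      T.map S.g.left ≫ δ = x₂ ≫ α - T.map b ≫ z :=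
    ⟨(exact_map_left hS).desc _ hδ, (exact_map_left hS).g_desc _ hδ⟩
  have : Subsingleton (Abelian.Ext.{w₁} (ShortComplex.mk x₃ (cokernel.π x₃)
      (cokernel.condition x₃)).X₃ W.right 1) := hC.perpProjective.{w₁} _ ‹_› 0
  obtain ⟨ε, hε⟩ := exists_extension_of_ext_one hφ W.right δ
  change S.X₃.right ⟶ W.right at ε
  change x₃ ≫ ε = δ at hε
  have hβ : x₂ ≫ (α - S.g.right ≫ ε) = T.map b ≫ z := by
    rw [Preadditive.comp_sub, ← reassoc_of% hg, hε, hδ', sub_sub_cancel]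
  refine ⟨{ left := b, right := α - S.g.right ≫ ε, w := hβ.symm }, ?_⟩
  ext
  · exact hb
  · change S.f.right ≫ (α - S.g.right ≫ ε) = a.right
    rw [Preadditive.comp_sub, hα, reassoc_of% hfg, zero_comp, sub_zero]

variable [EnoughProjectives ℬ] [HasExt.{w₃} (Comma T (𝟭 𝒜))]

lemma subsingleton_ext_of_mem_gorensteinClass
    (hT : ∀ S : ShortComplex ℬ, S.ShortExact → IsGorensteinProjective S.X₃ → Mono (T.map S.f))
    (hP : ∀ Q : ℬ, Projective Q → Projective (T.obj Q))
    (hGP : ∀ G : ℬ, IsGorensteinProjective G → IsGorensteinProjective (T.obj G))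
    {X W : Comma T (𝟭 𝒜)} (hX : X ∈ gorensteinClass T) (hW : W ∈ projectiveClass T)
    (n : ℕ) : Subsingleton (Abelian.Ext.{w₃} X W (n + 1)) := by
  induction n generalizing X with
  | zero =>
    obtain ⟨S, hS, rfl, h₂, h₁⟩ := exists_generator.{w₁, w₂} hT X hX
    have := projective_of_mem_projectiveClass h₂
    exact ext_one_of_exists_extension hS W
      (exists_extension_of_mem_gorensteinClass.{w₁, w₂} hP hGP hS hX hW)
  | succ n ih =>
    obtain ⟨S, hS, rfl, h₂, h₁⟩ := exists_generator.{w₁, w₂} hT X hX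
    have := projective_of_mem_projectiveClass h₂
    exact ext_succ_of_projective hS W (ih h₁)

lemma isStrongLeftFrobeniusPair_gorensteinClass
    (hT : ∀ S : ShortComplex ℬ, S.ShortExact → IsGorensteinProjective S.X₃ → Mono (T.map S.f))
    (hP : ∀ Q : ℬ, Projective Q → Projective (T.obj Q))
    (hGP : ∀ G : ℬ, IsGorensteinProjective G → IsGorensteinProjective (T.obj G)) :
    IsStrongLeftFrobeniusPair.{w₃} (gorensteinClass T) (projectiveClass T) where
  closed_extensions _ := gorensteinClass_of_extension.{w₁, w₂}
  closed_kernels_of_epis _ := gorensteinClass_of_kernel.{w₁, w₂} hT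
  closed_summands_X _ _ _ hC := fun ⟨e⟩ => gorensteinClass_of_retract.{w₁, w₂}
    ⟨biprod.inl ≫ e.inv, e.hom ≫ biprod.fst, by simp⟩ hC
  closed_summands_W _ _ _ hC := fun ⟨e⟩ => projectiveClass_of_retract
    ⟨biprod.inl ≫ e.inv, e.hom ≫ biprod.fst, by simp⟩ hC
  W_subset_X := projectiveClass_subset.{w₁, w₂}
  W_subset_rightPerp W hW X hX i hi := by
    obtain ⟨n, rfl⟩ := Nat.exists_eq_add_of_le' hi
    exact subsingleton_ext_of_mem_gorensteinClass.{w₁, w₂} hT hP hGP hX hW n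
  cogenerator := exists_cogenerator.{w₁, w₂} hT hP
  W_subset_leftPerp W hW X _ i hi := by
    obtain ⟨n, rfl⟩ := Nat.exists_eq_add_of_le' hi
    have := projective_of_mem_projectiveClass hW
    exact Abelian.Ext.subsingleton_of_projective W X n
  generator := exists_generator.{w₁, w₂} hT

end CommaPerp

end Paper

/-- from Corollary 4.6: if `T` is a compatible right exact functor which
preserves projective objects and Gorenstein projective objects, then
`(𝔅^{𝒢𝒫_𝒜}_{𝒢𝒫_ℬ}, 𝔅^{𝒫_𝒜}_{𝒫_ℬ})` is a strong left Frobenius pair in `(T ↓ 𝒜)`. -/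
theorem statement15
    {𝒜 : Type u} [Category.{v} 𝒜] [Abelian 𝒜] [EnoughProjectives 𝒜] [EnoughInjectives 𝒜]
    {ℬ : Type u'} [Category.{v'} ℬ] [Abelian ℬ] [EnoughProjectives ℬ] [EnoughInjectives ℬ]
    (T : ℬ ⥤ 𝒜) [T.Additive] [PreservesFiniteColimits T]
    [Abelian (Comma T (𝟭 𝒜))]
    [HasExt.{w₃} (Comma T (𝟭 𝒜))]
    (hcompat : Compatible T)
    (hP : ∀ Q : ℬ, Projective Q → Projective (T.obj Q))
    (hGP : ∀ G : ℬ, IsGorensteinProjective G → IsGorensteinProjective (T.obj G)) :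
    IsStrongLeftFrobeniusPair
      (CommaClass T {M : 𝒜 | IsGorensteinProjective M} {M : ℬ | IsGorensteinProjective M})
      (CommaClass T {M : 𝒜 | Projective M} {M : ℬ | Projective M}) := by
  have : HasExt.{max u v} 𝒜 := HasExt.standard 𝒜
  have : HasExt.{max u' v'} ℬ := HasExt.standard ℬ
  exact isStrongLeftFrobeniusPair_gorensteinClass.{max u v, max u' v'}
    (fun _ hS h₃ => mono_map_of_isGorensteinProjective T hcompat.1 hS h₃) hP hGP
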